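/- Let W ⊆ ℂ be a nonempty, bounded, open, connected set. Then T(W) is a nonempty, bounded, open, connected, simply connected set, and ∂T(W) ⊆ ∂W. -/

import Mathlib

/-- `T(V)`: the union of `V` with all bounded connected components of `ℂ \ V`
(the topological hull of `V`). -/
def hullT (V : Set ℂ) : Set ℂ :=
  V ∪ {z | z ∉ V ∧ Bornology.IsBounded (connectedComponentIn Vᶜ z)}

/-- A horizontal block of grid cells: the cells in row `row` with column between `left` and
`right`. -/
@[ext]
structure GridRun where
  row : ℤ
  left : ℤ
  right : ℤ
deriving DecidableEq

namespace GridRun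

/-- `r` is a maximal block of cells of `S`. -/
def IsRun (S : ℤ → ℤ → Prop) (r : GridRun) : Prop :=
  r.left ≤ r.right ∧ (∀ i, r.left ≤ i → i ≤ r.right → S i r.row) ∧
    ¬ S (r.left - 1) r.row ∧ ¬ S (r.right + 1) r.row

/-- The blocks lie in consecutive rows and their closed rectangles meet. -/
def Touch (r s : GridRun) : Prop :=
  (r.row = s.row + 1 ∨ s.row = r.row + 1) ∧ r.left ≤ s.right + 1 ∧ s.left ≤ r.right + 1

variable {S : ℤ → ℤ → Prop}

lemma IsRun.eq_of_overlap {r s : GridRun} (hr : IsRun S r) (hs : IsRun S s)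
    (hrow : r.row = s.row) (h₁ : r.left ≤ s.right + 1) (h₂ : s.left ≤ r.right + 1) : r = s := by
  obtain ⟨hr0, hr1, hr2, hr3⟩ := hr
  obtain ⟨hs0, hs1, hs2, hs3⟩ := hs
  have e1 : r.left = s.left := by
    rcases lt_trichotomy r.left s.left with h | h | h
    · exact absurd (hrow ▸ hr1 (s.left - 1) (by omega) (by omega)) hs2
    · exact h
    · exact absurd (hrow ▸ hs1 (r.left - 1) (by omega) (by omega)) hr2
  have e2 : r.right = s.right := by
    rcases lt_trichotomy r.right s.right with h | h | h
    · exact absurd (hrow ▸ hs1 (r.right + 1) (by omega) (by omega)) hr3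
    · exact h
    · exact absurd (hrow ▸ hr1 (s.right + 1) (by omega) (by omega)) hs3
  exact GridRun.ext hrow e1 e2

lemma IsRun.lt_or_lt {r : GridRun} (hr : IsRun S r) {x y : ℤ} (hy : r.row = y) (hx : ¬ S x y) :
    r.right < x ∨ x < r.left := by
  by_contra! h
  exact hx (hy ▸ hr.2.1 x h.2 h.1)

/-- The number of pairs of `D` which go up from row `y` and start to the right of column `x`. -/
def upCount (D : Finset (GridRun × GridRun)) (x y : ℤ) : ℕ :=
  (D.filter fun e => e.1.row = y ∧ e.2.row = y + 1 ∧ x < e.1.left).card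

/-- The number of pairs of `D` which go down from row `y` and start to the right of column `x`. -/
def downCount (D : Finset (GridRun × GridRun)) (x y : ℤ) : ℕ :=
  (D.filter fun e => e.1.row = y ∧ y = e.2.row + 1 ∧ x < e.1.left).card

section Count

variable {D : Finset (GridRun × GridRun)}

lemma even_card_filter_fst (heven : ∀ r, Even (D.filter fun e => e.1 = r).card)
    (P : GridRun → Prop) [DecidablePred P] : Even (D.filter fun e => P e.1).card := by
  rw [Finset.card_eq_sum_card_fiberwise (f := Prod.fst) (t := (D.filter fun e => P e.1).image Prod.fst)
    (fun e he => Finset.mem_coe.2 (Finset.mem_image_of_mem _ he))]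
  refine Finset.even_sum _ fun r hr => ?_
  obtain ⟨e, he, rfl⟩ := Finset.mem_image.1 hr
  rw [Finset.filter_filter]
  rw [Finset.filter_congr (q := fun f => f.1 = e.1) fun f _ =>
    ⟨fun h => h.2, fun h => ⟨h ▸ (Finset.mem_filter.1 he).2, h⟩⟩]
  exact heven e.1

lemma card_filter_swap (hsymm : ∀ e ∈ D, e.swap ∈ D) (P : GridRun × GridRun → Prop)
    [DecidablePred P] :
    (D.filter P).card = (D.filter fun e => P e.swap).card := by
  refine Finset.card_bij (fun e _ => e.swap) ?_ ?_ ?_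
  · intro e he
    simp only [Finset.mem_filter, Prod.swap_swap] at he ⊢
    exact ⟨hsymm e he.1, he.2⟩
  · intro e _ f _ h
    exact Prod.swap_injective h
  · intro e he
    simp only [Finset.mem_filter] at he
    exact ⟨e.swap, by simpa using ⟨hsymm e he.1, he.2⟩, by simp⟩

lemma even_up_iff_even_down (heven : ∀ r, Even (D.filter fun e => e.1 = r).card)
    (hadj : ∀ e ∈ D, IsRun S e.1 ∧ IsRun S e.2 ∧ Touch e.1 e.2) (x y : ℤ) :
    Even (upCount D x y) ↔ Even (downCount D x y) := by
  have h := even_card_filter_fst heven (fun r => r.row = y ∧ x < r.left)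
  have : (D.filter fun e => e.1.row = y ∧ x < e.1.left).card = upCount D x y + downCount D x y := by
    rw [upCount, downCount, ← Finset.card_union_of_disjoint]
    · congr 1
      ext e
      simp only [Finset.mem_filter, Finset.mem_union]
      constructor
      · rintro ⟨he, h1, h2⟩
        have := (hadj e he).2.2.1
        grind
      · grind
    · rw [Finset.disjoint_left]
      intro e
      simp only [Finset.mem_filter]
      grind
  rw [this] at h
  exact Nat.even_add.1 h

lemma upCount_eq_downCount (hsymm : ∀ e ∈ D, e.swap ∈ D)
    (hadj : ∀ e ∈ D, IsRun S e.1 ∧ IsRun S e.2 ∧ Touch e.1 e.2) {x y : ℤ}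
    (h₁ : ¬ S x y) (h₂ : ¬ S x (y + 1)) : upCount D x y = downCount D x (y + 1) := by
  rw [upCount, downCount, card_filter_swap hsymm]
  congr 1
  ext e
  simp only [Finset.mem_filter, Prod.fst_swap, Prod.snd_swap, and_congr_right_iff]
  intro he
  obtain ⟨hr, hs, ht⟩ := hadj e he
  constructor
  · rintro ⟨ha, hb, hc⟩
    have := hr.lt_or_lt hb h₂
    exact ⟨hb, by omega, by have := ht.2; omega⟩
  · rintro ⟨ha, hb, hc⟩
    have := hs.lt_or_lt (by omega) h₁
    exact ⟨by omega, ha, by have := ht.2; omega⟩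

lemma even_upCount_vertical (heven : ∀ r, Even (D.filter fun e => e.1 = r).card)
    (hsymm : ∀ e ∈ D, e.swap ∈ D)
    (hadj : ∀ e ∈ D, IsRun S e.1 ∧ IsRun S e.2 ∧ Touch e.1 e.2) {x y : ℤ}
    (h₁ : ¬ S x y) (h₂ : ¬ S x (y + 1)) :
    Even (upCount D x y) ↔ Even (upCount D x (y + 1)) := by
  rw [even_up_iff_even_down heven hadj x (y + 1), upCount_eq_downCount hsymm hadj h₁ h₂]

lemma upCount_horizontal (hadj : ∀ e ∈ D, IsRun S e.1 ∧ IsRun S e.2 ∧ Touch e.1 e.2) {x y : ℤ}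
    (h : ¬ S (x + 1) y) : upCount D x y = upCount D (x + 1) y := by
  rw [upCount, upCount]
  congr 1
  ext e
  simp only [Finset.mem_filter, and_congr_right_iff]
  intro he hy _
  obtain ⟨hr, -⟩ := hadj e he
  have := hr.lt_or_lt hy h
  have := hr.1
  omega

/-- A nonempty even symmetric set of adjacent pairs of runs encloses a cell outside `S`. -/
lemma exists_odd_upCount (heven : ∀ r, Even (D.filter fun e => e.1 = r).card)
    (hsymm : ∀ e ∈ D, e.swap ∈ D)
    (hadj : ∀ e ∈ D, IsRun S e.1 ∧ IsRun S e.2 ∧ Touch e.1 e.2) (hne : D.Nonempty) :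
    ∃ x y, ¬ S x y ∧ ¬ Even (upCount D x y) := by
  obtain ⟨⟨r₀, A₀⟩, he₀, hmax⟩ := D.exists_max_image (fun e => e.1.row) hne
  simp only at hmax
  obtain ⟨⟨r, A⟩, he₁, hmin⟩ := (D.filter fun e => e.1 = r₀).exists_min_image (fun e => e.2.left)
    ⟨(r₀, A₀), by simp [he₀]⟩
  simp only [Finset.mem_filter] at he₁ hmin
  obtain ⟨he₁, rfl⟩ := he₁
  have hdown : ∀ e ∈ D, e.1.row = r.row → e.2.row + 1 = r.row := by
    intro e he h
    have h1 := (hadj e he).2.2.1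
    have h2 := hmax _ (hsymm e he)
    simp only [Prod.fst_swap] at h2
    omega
  obtain ⟨hrS, hAS, -, htA⟩ := hadj _ he₁
  have hrowA := hdown _ he₁ rfl
  simp only at hrS hAS htA hrowA
  have hother : ∀ e ∈ D, e.1 = r → e.2 ≠ A → A.right + 1 < e.2.left := by
    intro e he h hne
    by_contra! hle
    have h1 : A.left ≤ e.2.left := hmin e ⟨he, h⟩
    have h2 := hdown e he (by rw [h])
    have h3 := (hadj e he).2.1
    exact hne (h3.eq_of_overlap hAS (by omega) hle (by have := h3.1; omega))
  obtain ⟨e₂, he₂, he₂r, he₂A⟩ : ∃ e ∈ D, e.1 = r ∧ e.2 ≠ A := by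
    have h2 := heven r
    have h1 : 0 < (D.filter fun e => e.1 = r).card := Finset.card_pos.2 ⟨(r, A), by simp [he₁]⟩
    obtain ⟨e, he, hne⟩ := Finset.exists_mem_ne (s := D.filter fun e => e.1 = r)
      (by obtain ⟨k, hk⟩ := h2; omega) (r, A)
    simp only [Finset.mem_filter] at he
    exact ⟨e, he.1, he.2, fun h => hne (Prod.ext (he.2) h)⟩
  have hB := hother e₂ he₂ he₂r he₂A
  have htB := (hadj e₂ he₂).2.2.2
  rw [he₂r] at htB
  refine ⟨A.right + 1, A.row, hAS.2.2.2, fun hev => ?_⟩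
  have hP := even_card_filter_fst heven (fun s => s.row = r.row ∧ r.left ≤ s.left)
  rw [upCount, card_filter_swap hsymm] at hev
  have key : (D.filter fun e => e.1.row = r.row ∧ r.left ≤ e.1.left) =
      insert (r, A) (D.filter fun e : GridRun × GridRun => e.swap.1.row = A.row ∧
        e.swap.2.row = A.row + 1 ∧ A.right + 1 < e.swap.1.left) := by
    ext e
    simp only [Finset.mem_filter, Finset.mem_insert, Prod.fst_swap, Prod.snd_swap]
    constructor
    · rintro ⟨he, h1, h2⟩
      obtain ⟨g1, g2, g3⟩ := hadj e he
      have h4 := hdown e he h1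
      by_cases hes : e.1 = r
      · by_cases heA : e.2 = A
        · exact Or.inl (Prod.ext (hes) heA)
        · exact Or.inr ⟨he, by omega, by omega, hother e he hes heA⟩
      · right
        have h5 : r.right + 1 < e.1.left := by
          by_contra! hle
          exact hes (g1.eq_of_overlap hrS h1 hle (by have := g1.1; omega))
        have h6 := g2.lt_or_lt (y := A.row) (by omega) hAS.2.2.2
        exact ⟨he, by omega, by omega, by have := g3.2; omega⟩
    · rintro (rfl | ⟨he, h1, h2, h3⟩)
      · exact ⟨he₁, rfl, le_rfl⟩
      · obtain ⟨g1, g2, g3⟩ := hadj e he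
        refine ⟨he, by omega, ?_⟩
        by_contra! hlt
        have h5 : e.1.right + 1 < r.left := by
          by_contra! hle
          have := g1.eq_of_overlap hrS (by omega) (by have := hrS.1; omega) hle
          rw [this] at hlt
          omega
        have := g3.2
        omega
  rw [key, Finset.card_insert_of_notMem (by
    have := hAS.1
    simp only [Finset.mem_filter, Prod.fst_swap]
    omega)] at hP
  rw [Nat.even_add_one] at hP
  exact hP hev

end Count

/-- The graph of the runs of `S`. -/
def graph (S : ℤ → ℤ → Prop) : SimpleGraph GridRun where
  Adj r s := IsRun S r ∧ IsRun S s ∧ Touch r s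
  symm := ⟨fun r s h => ⟨h.2.1, h.1, h.2.2.1.symm, h.2.2.2.2, h.2.2.2.1⟩⟩
  loopless := ⟨fun r h => by have := h.2.2.1; omega⟩

/-- The pairs of consecutive vertices of a closed trail form an even symmetric set. -/
lemma exists_even_of_trail {V : Type*} [DecidableEq V] {G : SimpleGraph V} {v : V} {p : G.Walk v v}
    (hp : p.IsTrail) (hne : p.edges ≠ []) :
    ∃ D : Finset (V × V), D.Nonempty ∧ (∀ e ∈ D, e.swap ∈ D) ∧ (∀ e ∈ D, G.Adj e.1 e.2) ∧
      ∀ r, Even (D.filter fun e => e.1 = r).card := by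
  refine ⟨(p.support.toFinset ×ˢ p.support.toFinset).filter fun e => s(e.1, e.2) ∈ p.edges,
    ?_, ?_, ?_, ?_⟩
  · obtain ⟨e, he⟩ := List.exists_mem_of_ne_nil _ hne
    induction e with | h a b =>
    exact ⟨(a, b), by simp [he, p.fst_mem_support_of_mem_edges he, p.snd_mem_support_of_mem_edges he]⟩
  · rintro ⟨a, b⟩ h
    simp only [Finset.mem_filter, Finset.mem_product, Prod.swap_prod_mk] at h ⊢
    exact ⟨⟨h.1.2, h.1.1⟩, by rw [Sym2.eq_swap]; exact h.2⟩
  · rintro ⟨a, b⟩ h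
    simp only [Finset.mem_filter] at h
    exact p.adj_of_mem_edges h.2
  · intro r
    have h := (hp.even_countP_edges_iff r).2 (fun h => absurd rfl h)
    rw [List.countP_eq_length_filter, ← List.toFinset_card_of_nodup (hp.edges_nodup.filter _)] at h
    convert h using 1
    refine Finset.card_bij (fun e _ => s(e.1, e.2)) ?_ ?_ ?_
    · rintro ⟨a, b⟩ hab
      simp only [Finset.mem_filter] at hab
      obtain ⟨⟨-, hab⟩, rfl⟩ := hab
      simpa using hab
    · rintro ⟨a, b⟩ h ⟨c, d⟩ h' heq
      simp only [Finset.mem_filter] at h h'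
      obtain ⟨-, rfl⟩ := h
      obtain ⟨-, rfl⟩ := h'
      simpa using Sym2.congr_right.1 heq
    · intro e he
      simp only [List.mem_toFinset, List.mem_filter, decide_eq_true_eq] at he
      obtain ⟨he, b, rfl⟩ := he
      exact ⟨(r, b), by simp [he, p.fst_mem_support_of_mem_edges he,
        p.snd_mem_support_of_mem_edges he], rfl⟩

/-- Two distinct neighbours of a vertex outside a connected set lie on a closed trail. -/
lemma exists_trail_of_adj {V : Type*} {G : SimpleGraph V} {T : Set V}
    (hT : (G.induce T).Preconnected) {v a b : V} (hv : v ∉ T) (ha : a ∈ T) (hb : b ∈ T)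
    (hab : a ≠ b) (hva : G.Adj v a) (hvb : G.Adj v b) :
    ∃ p : G.Walk v v, p.IsTrail ∧ p.edges ≠ [] := by
  classical
  obtain ⟨q⟩ := hT ⟨a, ha⟩ ⟨b, hb⟩
  let q' : G.Walk a b := q.toPath.1.map (SimpleGraph.Embedding.induce T).toHom
  have hq' : q'.IsPath := q.toPath.2.map (f := (SimpleGraph.Embedding.induce T).toHom)
    (SimpleGraph.Embedding.induce (G := G) T).injective
  have hvq : v ∉ q'.support := by
    intro h
    obtain ⟨x, -, rfl⟩ := List.mem_map.1 (SimpleGraph.Walk.support_map _ q.toPath.1 ▸ h)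
    exact hv x.2
  refine ⟨.cons hva (q'.concat hvb.symm), ?_, by simp⟩
  rw [SimpleGraph.Walk.isTrail_cons]
  refine ⟨(hq'.concat hvq _).isTrail, ?_⟩
  rw [SimpleGraph.Walk.edges_concat, List.concat_eq_append, List.mem_append, not_or]
  refine ⟨fun h => hvq (q'.fst_mem_support_of_mem_edges h), ?_⟩
  simp only [List.mem_singleton, Sym2.eq_iff, not_or]
  grind

end GridRun

/-- Attaching a convex set along a retract of it does not affect simple connectedness. -/
lemma SimplyConnectedSpace.union_of_convex {E : Type*} [NormedAddCommGroup E] [NormedSpace ℝ E]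
    {A R : Set E} (hA : IsClosed A) (hR : IsClosed R) (hconv : Convex ℝ R)
    {ρ : E → E} (hρ : Continuous ρ) (hmaps : ∀ z ∈ R, ρ z ∈ A ∩ R) (hid : ∀ z ∈ A ∩ R, ρ z = z)
    [SimplyConnectedSpace A] : SimplyConnectedSpace ↥(A ∪ R) := by
  classical
  let g : E → E := A.piecewise id ρ
  have hgA : Set.EqOn g id A := fun z hz => Set.piecewise_eq_of_mem _ _ _ hz
  have hgR : Set.EqOn g ρ R := fun z hz => by
    by_cases hzA : z ∈ A
    · rw [hgA hzA, hid z ⟨hzA, hz⟩, id]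
    · exact Set.piecewise_eq_of_notMem _ _ _ hzA
  have hg : ContinuousOn g (A ∪ R) :=
    (continuousOn_id.congr hgA).union_of_isClosed (hρ.continuousOn.congr hgR) hA hR
  have hgm : Set.MapsTo g (A ∪ R) A := by
    rintro z (hz | hz)
    · rwa [hgA hz]
    · rw [hgR hz]
      exact (hmaps z hz).1
  have hgc : Continuous fun z : ↥(A ∪ R) => g z := hg.domRestrict
  let φ : C(↥(A ∪ R), A) := ⟨fun z => ⟨g z, hgm z.2⟩, hgc.subtype_mk _⟩
  let ι : C(A, ↥(A ∪ R)) := ⟨Set.inclusion Set.subset_union_left, continuous_inclusion _⟩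
  have hφι : φ.comp ι = ContinuousMap.id A := by
    ext z
    exact hgA z.2
  have hmem : ∀ (t : unitInterval) (z : ↥(A ∪ R)), AffineMap.lineMap (g z) (z : E) (t : ℝ) ∈ A ∪ R := by
    rintro t ⟨z, hz | hz⟩
    · left
      simpa [hgA hz] using hz
    · right
      refine hconv.lineMap_mem ?_ hz t.2
      simpa only [hgR hz] using (hmaps z hz).2
  have hιφ : (ι.comp φ).Homotopic (ContinuousMap.id _) := by
    refine ⟨⟨⟨fun p => ⟨AffineMap.lineMap (g p.2) (p.2 : E) (p.1 : ℝ), hmem p.1 p.2⟩, ?_⟩, ?_, ?_⟩⟩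
    · refine Continuous.subtype_mk ?_ _
      simp only [AffineMap.lineMap_apply_module]
      have h := hgc.comp (continuous_snd (X := unitInterval))
      exact ((by fun_prop : Continuous fun p : unitInterval × ↥(A ∪ R) => 1 - (p.1 : ℝ)).smul h).add
        (by fun_prop)
    · intro z
      ext
      simp [ι, φ]
    · intro z
      ext
      simp
  have e : ContinuousMap.HomotopyEquiv ↥(A ∪ R) A :=
    ⟨φ, ι, hιφ, hφι ▸ ContinuousMap.Homotopic.refl _⟩
  exact e.simplyConnectedSpace

open Complex in
lemma convex_Icc_reProdIm_Icc (a b c d : ℝ) : Convex ℝ (Set.Icc a b ×ℂ Set.Icc c d) :=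
  ((convex_Icc a b).is_linear_preimage (f := Complex.re) ⟨by simp, by simp⟩).inter
    ((convex_Icc c d).is_linear_preimage (f := Complex.im) ⟨by simp, by simp⟩)

open Complex in
/-- A nonempty closed rectangle is a retract of the plane. -/
lemma exists_retraction_Icc_reProdIm_Icc {a b c d : ℝ} (hab : a ≤ b) (hcd : c ≤ d) :
    ∃ ρ : ℂ → ℂ, Continuous ρ ∧ (∀ z, ρ z ∈ Set.Icc a b ×ℂ Set.Icc c d) ∧
      ∀ z ∈ Set.Icc a b ×ℂ Set.Icc c d, ρ z = z := by
  refine ⟨fun z => Complex.equivRealProdCLM.symm (max a (min b z.re), max c (min d z.im)),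
    by fun_prop, ?_, ?_⟩
  · intro z
    simp [Complex.mem_reProdIm, hab, hcd]
  · intro z hz
    simp only [Complex.mem_reProdIm, Set.mem_Icc] at hz
    apply Complex.ext <;> simp [hz]

namespace GridRun

variable {S : ℤ → ℤ → Prop} {δ : ℝ}

open Complex in
/-- The closed rectangle covered by a block, for the grid of mesh `δ`. -/
def rect (δ : ℝ) (r : GridRun) : Set ℂ :=
  Set.Icc (δ * r.left) (δ * (r.right + 1)) ×ℂ Set.Icc (δ * r.row) (δ * (r.row + 1))

lemma mem_rect {r : GridRun} {z : ℂ} : z ∈ rect δ r ↔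
    (δ * r.left ≤ z.re ∧ z.re ≤ δ * (r.right + 1)) ∧
      δ * r.row ≤ z.im ∧ z.im ≤ δ * (r.row + 1) := by
  simp [rect, Complex.mem_reProdIm]

lemma isClosed_rect (δ : ℝ) (r : GridRun) : IsClosed (rect δ r) :=
  isClosed_Icc.reProdIm isClosed_Icc

lemma convex_rect (δ : ℝ) (r : GridRun) : Convex ℝ (rect δ r) :=
  convex_Icc_reProdIm_Icc _ _ _ _

lemma exists_retraction_rect_inter {r s : GridRun} (h : (rect δ r ∩ rect δ s).Nonempty) :
    ∃ ρ : ℂ → ℂ, Continuous ρ ∧ (∀ z, ρ z ∈ rect δ r ∩ rect δ s) ∧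
      ∀ z ∈ rect δ r ∩ rect δ s, ρ z = z := by
  have key : rect δ r ∩ rect δ s = Complex.reProdIm
      (Set.Icc (max (δ * r.left) (δ * s.left)) (min (δ * (r.right + 1)) (δ * (s.right + 1))))
      (Set.Icc (max (δ * r.row) (δ * s.row)) (min (δ * (r.row + 1)) (δ * (s.row + 1)))) := by
    ext z
    simp only [rect, Set.mem_inter_iff, Complex.mem_reProdIm, ← Set.Icc_inter_Icc]
    tauto
  obtain ⟨z, hz⟩ := h
  rw [key] at hz ⊢
  exact exists_retraction_Icc_reProdIm_Icc (hz.1.1.trans hz.1.2) (hz.2.1.trans hz.2.2)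

lemma int_le_add_one_of_mul_le (hδ : 0 < δ) {a b : ℤ} {x : ℝ} (h₁ : δ * a ≤ x)
    (h₂ : x ≤ δ * (b + 1)) : a ≤ b + 1 := by
  have h : (a : ℝ) ≤ b + 1 := le_of_mul_le_mul_left (h₁.trans h₂) hδ
  exact_mod_cast h

lemma IsRun.adj_of_mem_rect (hδ : 0 < δ) {r s : GridRun} (hr : IsRun S r) (hs : IsRun S s)
    (hrs : r ≠ s) {z : ℂ} (hzr : z ∈ rect δ r) (hzs : z ∈ rect δ s) : (graph S).Adj r s := by
  rw [mem_rect] at hzr hzs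
  have h₁ := int_le_add_one_of_mul_le hδ hzr.1.1 hzs.1.2
  have h₂ := int_le_add_one_of_mul_le hδ hzs.1.1 hzr.1.2
  have h₃ := int_le_add_one_of_mul_le hδ hzr.2.1 hzs.2.2
  have h₄ := int_le_add_one_of_mul_le hδ hzs.2.1 hzr.2.2
  have h₅ : r.row ≠ s.row := fun h => hrs (hr.eq_of_overlap hs h h₁ h₂)
  exact ⟨hr, hs, by omega, h₁, h₂⟩

/-- If the adjacency graph of the blocks has no closed trail, then a connected subset of the union
of the blocks is contained in a simply connected union of blocks. -/
lemma exists_simplyConnected_of_no_trail (hδ : 0 < δ) (hfin : {r | IsRun S r}.Finite)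
    (hno : ∀ (v : GridRun) (p : (graph S).Walk v v), p.IsTrail → p.edges = [])
    {K : Set ℂ} (hK : IsPreconnected K) (hKne : K.Nonempty)
    (hsub : K ⊆ ⋃ r ∈ {r | IsRun S r}, rect δ r) :
    ∃ T ⊆ {r | IsRun S r}, K ⊆ ⋃ r ∈ T, rect δ r ∧
      SimplyConnectedSpace ↥(⋃ r ∈ T, rect δ r) := by
  obtain ⟨z₀, hz₀⟩ := hKne
  obtain ⟨r₀, hr₀, hz₀r⟩ := Set.mem_iUnion₂.1 (hsub hz₀)
  let 𝒯 : Set (Set GridRun) := {T | T ⊆ {r | IsRun S r} ∧ r₀ ∈ T ∧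
    ((graph S).induce T).Preconnected ∧ SimplyConnectedSpace ↥(⋃ r ∈ T, rect δ r)}
  have h𝒯 : 𝒯.Finite := hfin.finite_subsets.subset fun T hT => hT.1
  have hbase : {r₀} ∈ 𝒯 := by
    refine ⟨by simpa using hr₀, rfl, ?_, ?_⟩
    · rintro ⟨a, rfl⟩ ⟨b, rfl⟩
      exact SimpleGraph.Reachable.refl _
    · rw [Set.biUnion_singleton]
      have := (convex_rect δ r₀).contractibleSpace ⟨z₀, hz₀r⟩
      exact SimplyConnectedSpace.ofContractible _
  obtain ⟨T, ⟨hTr, hT₀, hTc, hTs⟩, hmax⟩ := h𝒯.exists_maximal ⟨_, hbase⟩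
  have hclosed : ∀ T' ⊆ {r | IsRun S r}, IsClosed (⋃ r ∈ T', rect δ r) := fun T' hT' =>
    (hfin.subset hT').isClosed_biUnion fun r _ => isClosed_rect δ r
  have hmeet : ∀ s, IsRun S s → ∀ a ∈ T, ∀ z ∈ rect δ a, z ∈ rect δ s → s ∈ T := by
    intro s hs a ha z hza hzs
    by_contra hsT
    have hne : ∀ b ∈ T, s ≠ b := fun b hb h => hsT (h ▸ hb)
    have hadj := hs.adj_of_mem_rect hδ (hTr ha) (hne a ha) hzs hza
    have huniq : ∀ b ∈ T, ∀ w ∈ rect δ b, w ∈ rect δ s → b = a := by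
      intro b hb w hwb hws
      by_contra hba
      obtain ⟨p, hp, hpe⟩ := exists_trail_of_adj hTc hsT hb ha hba
        (hs.adj_of_mem_rect hδ (hTr hb) (hne b hb) hws hwb) hadj
      exact hpe (hno s p hp)
    obtain ⟨ρ, hρ, hρm, hρi⟩ := exists_retraction_rect_inter ⟨z, hza, hzs⟩
    have hunion := SimplyConnectedSpace.union_of_convex (hclosed T hTr) (isClosed_rect δ s)
      (convex_rect δ s) hρ (fun w _ => ⟨Set.mem_biUnion ha (hρm w).1, (hρm w).2⟩) (by
        rintro w ⟨hwT, hws⟩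
        obtain ⟨b, hb, hwb⟩ := Set.mem_iUnion₂.1 hwT
        exact hρi w ⟨huniq b hb w hwb hws ▸ hwb, hws⟩)
    have hmem : T ∪ {a, s} ∈ 𝒯 := by
      refine ⟨?_, Or.inl hT₀, ?_, ?_⟩
      · rintro x (hx | rfl | rfl)
        exacts [hTr hx, hTr ha, hs]
      · exact (SimpleGraph.induce_union_connected hTc
          (SimpleGraph.induce_pair_connected_of_adj hadj.symm).preconnected
          ⟨a, ha, by simp⟩).preconnected
      · have : T ∪ {a, s} = T ∪ {s} := by
          ext x
          simp only [Set.mem_union, Set.mem_insert_iff, Set.mem_singleton_iff]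
          grind
        rwa [this, Set.biUnion_union, Set.biUnion_singleton]
    exact hsT (hmax hmem Set.subset_union_left (Or.inr (by simp)))
  refine ⟨T, hTr, ?_, hTs⟩
  intro z hz
  by_contra hzT
  obtain ⟨w, -, hw₁, hw₂⟩ := isPreconnected_closed_iff.1 hK (⋃ r ∈ T, rect δ r)
    (⋃ r ∈ {r | IsRun S r} \ T, rect δ r) (hclosed T hTr) (hclosed _ Set.sdiff_subset)
    (by rwa [← Set.biUnion_union, Set.union_sdiff_cancel hTr])
    ⟨z₀, hz₀, Set.mem_biUnion hT₀ hz₀r⟩ (by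
      obtain ⟨s, hs, hzs⟩ := Set.mem_iUnion₂.1 (hsub hz)
      exact ⟨z, hz, Set.mem_biUnion ⟨hs, fun h => hzT (Set.mem_biUnion h hzs)⟩ hzs⟩)
  obtain ⟨a, ha, hwa⟩ := Set.mem_iUnion₂.1 hw₁
  obtain ⟨s, hs, hws⟩ := Set.mem_iUnion₂.1 hw₂
  exact hs.2 (hmeet s hs.1 a ha w hwa hws)

end GridRun

namespace GridRun

variable {S : ℤ → ℤ → Prop} {δ : ℝ}

lemma finite_setOf_isRun (hS : {p : ℤ × ℤ | S p.1 p.2}.Finite) : {r | IsRun S r}.Finite := by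
  refine Set.Finite.of_finite_image (f := fun r : GridRun => ((r.left, r.row), (r.right, r.row)))
    ((hS.prod hS).subset ?_) ?_
  · rintro _ ⟨r, hr, rfl⟩
    exact ⟨hr.2.1 _ le_rfl hr.1, hr.2.1 _ hr.1 le_rfl⟩
  · intro r _ s _ h
    simp only [Prod.mk.injEq] at h
    exact GridRun.ext h.1.2 h.1.1 h.2.1

lemma exists_isRun (hS : {p : ℤ × ℤ | S p.1 p.2}.Finite) {x y : ℤ} (hxy : S x y) :
    ∃ r, IsRun S r ∧ r.row = y ∧ r.left ≤ x ∧ x ≤ r.right := by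
  have hfin : {i | S i y}.Finite :=
    hS.preimage (f := fun i => (i, y)) fun i _ j _ h => (Prod.mk.inj h).1
  obtain ⟨M, hM⟩ := hfin.bddAbove
  obtain ⟨m, hm⟩ := hfin.bddBelow
  obtain ⟨b, ⟨hb₁, hb₂⟩, hb₃⟩ := Int.exists_greatest_of_bdd
    (P := fun k => x ≤ k ∧ ∀ i, x ≤ i → i ≤ k → S i y) ⟨M, fun k hk => hM (hk.2 k hk.1 le_rfl)⟩
    ⟨x, le_rfl, fun i h₁ h₂ => le_antisymm h₁ h₂ ▸ hxy⟩
  obtain ⟨a, ⟨ha₁, ha₂⟩, ha₃⟩ := Int.exists_least_of_bdd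
    (P := fun k => k ≤ x ∧ ∀ i, k ≤ i → i ≤ x → S i y) ⟨m, fun k hk => hm (hk.2 k le_rfl hk.1)⟩
    ⟨x, le_rfl, fun i h₁ h₂ => le_antisymm h₁ h₂ ▸ hxy⟩
  refine ⟨⟨y, a, b⟩, ⟨ha₁.trans hb₁, fun i h₁ h₂ => ?_, fun h => ?_, fun h => ?_⟩, rfl, ha₁, hb₁⟩
  · rcases le_total i x with h | h
    exacts [ha₂ i h₁ h, hb₂ i h h₂]
  · have := ha₃ (a - 1) ⟨by omega, fun i h₁ h₂ => by
      rcases eq_or_lt_of_le h₁ with rfl | h'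
      exacts [h, ha₂ i (by omega) h₂]⟩
    omega
  · have := hb₃ (b + 1) ⟨by omega, fun i h₁ h₂ => by
      rcases eq_or_lt_of_le h₂ with rfl | h'
      exacts [h, hb₂ i h₁ (by omega)]⟩
    omega

/-- The closed grid cell in column `x` and row `y`. -/
def cell (δ : ℝ) (x y : ℤ) : Set ℂ := rect δ ⟨y, x, x⟩

lemma mem_cell {x y : ℤ} {z : ℂ} : z ∈ cell δ x y ↔
    (δ * x ≤ z.re ∧ z.re ≤ δ * (x + 1)) ∧ δ * y ≤ z.im ∧ z.im ≤ δ * (y + 1) :=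
  mem_rect

lemma mem_cell_floor (hδ : 0 < δ) (z : ℂ) : z ∈ cell δ ⌊z.re / δ⌋ ⌊z.im / δ⌋ := by
  rw [mem_cell]
  have h (t : ℝ) : δ * ⌊t / δ⌋ ≤ t ∧ t ≤ δ * (⌊t / δ⌋ + 1) := by
    rw [← le_div_iff₀' hδ, ← div_le_iff₀' hδ]
    exact ⟨Int.floor_le _, (Int.lt_floor_add_one _).le⟩
  exact ⟨h _, h _⟩

lemma cell_subset_rect (hδ : 0 < δ) {r : GridRun} {x : ℤ} (h₁ : r.left ≤ x) (h₂ : x ≤ r.right) :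
    cell δ x r.row ⊆ rect δ r := by
  intro z hz
  rw [mem_cell] at hz
  rw [mem_rect]
  have h₁' : (r.left : ℝ) ≤ x := by exact_mod_cast h₁
  have h₂' : (x : ℝ) ≤ r.right := by exact_mod_cast h₂
  refine ⟨⟨le_trans ?_ hz.1.1, hz.1.2.trans ?_⟩, hz.2⟩ <;> gcongr

lemma exists_mem_cell_of_mem_rect (hδ : 0 < δ) {r : GridRun} (hr : r.left ≤ r.right) {z : ℂ}
    (hz : z ∈ rect δ r) : ∃ x, r.left ≤ x ∧ x ≤ r.right ∧ z ∈ cell δ x r.row := by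
  rw [mem_rect] at hz
  have hf := mem_cell.1 (mem_cell_floor hδ z)
  have hl : r.left ≤ ⌊z.re / δ⌋ := by
    rw [Int.le_floor, le_div_iff₀' hδ]
    exact hz.1.1
  rcases le_total ⌊z.re / δ⌋ r.right with h | h
  · exact ⟨_, hl, h, mem_cell.2 ⟨hf.1, hz.2⟩⟩
  · refine ⟨r.right, hr, le_rfl, mem_cell.2 ⟨⟨le_trans ?_ hf.1.1, hz.1.2⟩, hz.2⟩⟩
    have h' : (r.right : ℝ) ≤ ⌊z.re / δ⌋ := by exact_mod_cast h
    gcongr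

lemma finite_setOf_cell_inter_nonempty (hδ : 0 < δ) {B : Set ℂ} (hB : Bornology.IsBounded B) :
    {p : ℤ × ℤ | (cell δ p.1 p.2 ∩ B).Nonempty}.Finite := by
  obtain ⟨M, hM⟩ := hB.subset_closedBall 0
  have key {x : ℤ} {t : ℝ} (ht : |t| ≤ M) (h₁ : δ * x ≤ t) (h₂ : t ≤ δ * (x + 1)) :
      x ∈ Set.Icc ⌊-M / δ - 1⌋ ⌈M / δ⌉ := by
    rw [abs_le] at ht
    constructor
    · have : -M / δ ≤ x + 1 := (div_le_iff₀' hδ).2 (ht.1.trans h₂)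
      exact_mod_cast (Int.floor_le _).trans (by linarith : -M / δ - 1 ≤ (x : ℝ))
    · have : (x : ℝ) ≤ M / δ := (le_div_iff₀' hδ).2 (h₁.trans ht.2)
      exact_mod_cast this.trans (Int.le_ceil _)
  refine ((Set.finite_Icc ⌊-M / δ - 1⌋ ⌈M / δ⌉).prod
    (Set.finite_Icc ⌊-M / δ - 1⌋ ⌈M / δ⌉)).subset ?_
  rintro ⟨x, y⟩ ⟨z, hz, hzB⟩
  have hzM := mem_closedBall_zero_iff.1 (hM hzB)
  rw [mem_cell] at hz
  exact ⟨key ((Complex.abs_re_le_norm z).trans hzM) hz.1.1 hz.1.2,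
    key ((Complex.abs_im_le_norm z).trans hzM) hz.2.1 hz.2.2⟩

lemma finite_setOf_cell_subset (hδ : 0 < δ) {U : Set ℂ} (hU : Bornology.IsBounded U) :
    {p : ℤ × ℤ | cell δ p.1 p.2 ⊆ U}.Finite := by
  refine (finite_setOf_cell_inter_nonempty hδ hU).subset fun p hp => ?_
  have h : (⟨δ * p.1, δ * p.2⟩ : ℂ) ∈ cell δ p.1 p.2 := by
    rw [mem_cell]
    refine ⟨⟨le_rfl, ?_⟩, le_rfl, ?_⟩ <;> simp only <;> nlinarith
  exact ⟨_, h, hp h⟩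

lemma isClosed_iUnion_cell (hδ : 0 < δ) (Q : ℤ × ℤ → Prop) :
    IsClosed (⋃ p : {p // Q p}, cell δ p.1.1 p.1.2) := by
  have h : LocallyFinite fun p : ℤ × ℤ => cell δ p.1 p.2 := fun z =>
    ⟨Metric.ball z 1, Metric.ball_mem_nhds z one_pos,
      finite_setOf_cell_inter_nonempty hδ Metric.isBounded_ball⟩
  exact (h.comp_injective Subtype.val_injective).isClosed_iUnion fun p => isClosed_rect δ _

/-- If the complement of `U` is connected, there is no cycle of grid blocks in `U`. -/
lemma eq_empty_of_even (hδ : 0 < δ) {U : Set ℂ} (hU : Bornology.IsBounded U)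
    (hUc : IsPreconnected Uᶜ) {D : Finset (GridRun × GridRun)}
    (heven : ∀ r, Even (D.filter fun e => e.1 = r).card) (hsymm : ∀ e ∈ D, e.swap ∈ D)
    (hadj : ∀ e ∈ D, (graph fun x y => cell δ x y ⊆ U).Adj e.1 e.2) : D = ∅ := by
  by_contra hne
  rw [← ne_eq, ← Finset.nonempty_iff_ne_empty] at hne
  obtain ⟨x₁, y₁, hS₁, hodd⟩ := exists_odd_upCount heven hsymm hadj hne
  obtain ⟨x₀, y₀, hS₀, heven₀⟩ : ∃ x y, ¬ cell δ x y ⊆ U ∧ Even (upCount D x y) := by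
    obtain ⟨M, hM⟩ := (((finite_setOf_cell_subset hδ hU).image Prod.fst).union
      (D.finite_toSet.image fun e => e.1.left)).bddAbove
    refine ⟨M + 1, 0, fun h => ?_, ?_⟩
    · have := hM (Or.inl ⟨(M + 1, 0), h, rfl⟩)
      simp at this
    · have : upCount D (M + 1) 0 = 0 := by
        rw [upCount, Finset.card_eq_zero, Finset.filter_eq_empty_iff]
        rintro e he ⟨-, -, h⟩
        have : e.1.left ≤ M := hM (Or.inr ⟨e, he, rfl⟩)
        omega
      simp [this]
  obtain ⟨z₀, hz₀, hz₀U⟩ := Set.not_subset.1 hS₀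
  obtain ⟨z₁, hz₁, hz₁U⟩ := Set.not_subset.1 hS₁
  obtain ⟨z, hzU, hze, hzo⟩ := isPreconnected_closed_iff.1 hUc _ _
    (isClosed_iUnion_cell hδ fun p => Even (upCount D p.1 p.2))
    (isClosed_iUnion_cell hδ fun p => ¬ Even (upCount D p.1 p.2))
    (fun z _ => by
      by_cases h : Even (upCount D ⌊z.re / δ⌋ ⌊z.im / δ⌋)
      · exact Or.inl (Set.mem_iUnion.2 ⟨⟨(_, _), h⟩, mem_cell_floor hδ z⟩)
      · exact Or.inr (Set.mem_iUnion.2 ⟨⟨(_, _), h⟩, mem_cell_floor hδ z⟩))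
    ⟨z₀, hz₀U, Set.mem_iUnion.2 ⟨⟨(_, _), heven₀⟩, hz₀⟩⟩
    ⟨z₁, hz₁U, Set.mem_iUnion.2 ⟨⟨(_, _), hodd⟩, hz₁⟩⟩
  obtain ⟨⟨⟨i, j⟩, he⟩, hij⟩ := Set.mem_iUnion.1 hze
  obtain ⟨⟨⟨i', j'⟩, ho⟩, hij'⟩ := Set.mem_iUnion.1 hzo
  simp only at he ho hij hij'
  have hnot {a b : ℤ} (h : z ∈ cell δ a b) : ¬ cell δ a b ⊆ U := fun h' => hzU (h' h)
  have hmid : z ∈ cell δ i' j := mem_cell.2 ⟨(mem_cell.1 hij').1, (mem_cell.1 hij).2⟩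
  have hhor : upCount D i j = upCount D i' j := by
    have h₁ := int_le_add_one_of_mul_le hδ (mem_cell.1 hij).1.1 (mem_cell.1 hij').1.2
    have h₂ := int_le_add_one_of_mul_le hδ (mem_cell.1 hij').1.1 (mem_cell.1 hij).1.2
    obtain rfl | rfl | rfl : i' = i ∨ i' = i + 1 ∨ i = i' + 1 := by omega
    · rfl
    · exact upCount_horizontal hadj (hnot hmid)
    · exact (upCount_horizontal hadj (hnot hij)).symm
  have hver : Even (upCount D i' j) ↔ Even (upCount D i' j') := by
    have h₁ := int_le_add_one_of_mul_le hδ (mem_cell.1 hij).2.1 (mem_cell.1 hij').2.2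
    have h₂ := int_le_add_one_of_mul_le hδ (mem_cell.1 hij').2.1 (mem_cell.1 hij).2.2
    obtain rfl | rfl | rfl : j' = j ∨ j' = j + 1 ∨ j = j' + 1 := by omega
    · rfl
    · exact even_upCount_vertical heven hsymm hadj (hnot hmid) (hnot hij')
    · exact (even_upCount_vertical heven hsymm hadj (hnot hij') (hnot hmid)).symm
  exact ho (hver.1 (hhor ▸ he))

lemma edges_eq_nil_of_isTrail (hδ : 0 < δ) {U : Set ℂ} (hU : Bornology.IsBounded U)
    (hUc : IsPreconnected Uᶜ) {v : GridRun}
    {p : (graph fun x y => cell δ x y ⊆ U).Walk v v} (hp : p.IsTrail) : p.edges = [] := by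
  by_contra hne
  obtain ⟨D, hD, hsymm, hadj, heven⟩ := exists_even_of_trail hp hne
  exact hD.ne_empty (eq_empty_of_even hδ hU hUc heven hsymm hadj)

end GridRun

open GridRun in
/-- A bounded open set with connected complement contains a simply connected neighbourhood of each
of its nonempty connected compact subsets. -/
lemma exists_simplyConnectedSpace_between {U K : Set ℂ} (hUo : IsOpen U)
    (hUb : Bornology.IsBounded U) (hUc : IsPreconnected Uᶜ) (hK : IsCompact K)
    (hKc : IsConnected K) (hKU : K ⊆ U) : ∃ X, K ⊆ X ∧ X ⊆ U ∧ SimplyConnectedSpace X := by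
  obtain ⟨ε, hε, hKε⟩ := hK.exists_thickening_subset_open hUo hKU
  have hδ : 0 < ε / 3 := by positivity
  have hcell {x y : ℤ} {z : ℂ} (hz : z ∈ K) (hzc : z ∈ cell (ε / 3) x y) :
      cell (ε / 3) x y ⊆ U := by
    intro w hw
    refine hKε (Metric.mem_thickening_iff.2 ⟨z, hz, ?_⟩)
    rw [mem_cell] at hzc hw
    rw [dist_eq_norm]
    have hre : |(w - z).re| ≤ ε / 3 := by
      rw [Complex.sub_re, abs_le]
      constructor <;> linarith
    have him : |(w - z).im| ≤ ε / 3 := by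
      rw [Complex.sub_im, abs_le]
      constructor <;> linarith
    linarith [Complex.norm_le_abs_re_add_abs_im (w - z)]
  have hfin := finite_setOf_cell_subset hδ hUb
  obtain ⟨T, hT, hKT, hTs⟩ := exists_simplyConnected_of_no_trail hδ (finite_setOf_isRun hfin)
    (fun v p hp => edges_eq_nil_of_isTrail hδ hUb hUc hp) hKc.isPreconnected hKc.nonempty (by
      intro z hz
      obtain ⟨r, hr, hrow, h₁, h₂⟩ := exists_isRun
        (S := fun x y => cell (ε / 3) x y ⊆ U) hfin (hcell hz (mem_cell_floor hδ z))
      refine Set.mem_biUnion hr (cell_subset_rect hδ h₁ h₂ ?_)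
      rw [hrow]
      exact mem_cell_floor hδ z)
  refine ⟨_, hKT, Set.iUnion₂_subset fun r hr z hz => ?_, hTs⟩
  obtain ⟨x, h₁, h₂, hx⟩ := exists_mem_cell_of_mem_rect hδ (hT hr).1 hz
  exact (hT hr).2.1 x h₁ h₂ hx

/-- A bounded domain in the plane with connected complement is simply connected. -/
theorem IsOpen.simplyConnectedSpace_of_isPreconnected_compl {U : Set ℂ} (hUo : IsOpen U)
    (hUb : Bornology.IsBounded U) (hUc : IsPreconnected Uᶜ) (hU : IsConnected U) :
    SimplyConnectedSpace U := by
  have hpath : PathConnectedSpace U :=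
    isPathConnected_iff_pathConnectedSpace.1 (hUo.isConnected_iff_isPathConnected.1 hU)
  rw [simply_connected_iff_loops_nullhomotopic]
  refine ⟨hpath, fun x γ => ?_⟩
  obtain ⟨X, hKX, hXU, hX⟩ := exists_simplyConnectedSpace_between hUo hUb hUc
    (K := Set.range fun t => (γ t : ℂ)) (isCompact_range (by fun_prop))
    (isConnected_range (by fun_prop)) (by rintro _ ⟨t, rfl⟩; exact (γ t).2)
  have hxX : (x : ℂ) ∈ X := hKX ⟨0, by simp⟩
  let γ' : Path (⟨x, hxX⟩ : X) ⟨x, hxX⟩ :=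
    { toFun := fun t => ⟨γ t, hKX ⟨t, rfl⟩⟩
      continuous_toFun := by fun_prop
      source' := by simp
      target' := by simp }
  exact (SimplyConnectedSpace.paths_homotopic γ' (Path.refl _)).map
    ⟨Set.inclusion hXU, continuous_inclusion hXU⟩

lemma isPreconnected_setOf_le_norm (R : ℝ) :
    IsPreconnected {z : ℂ | R ≤ ‖z‖} := by
  have h : {z : ℂ | R ≤ ‖z‖} =
      (fun p : ℝ × ℝ => (p.1 : ℂ) * Complex.exp (p.2 * Complex.I)) '' (Set.Ici R ×ˢ Set.univ) := by
    ext z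
    simp only [Set.mem_ofPred_eq, Set.mem_image, Set.mem_prod, Set.mem_Ici, Set.mem_univ, and_true,
      Prod.exists]
    constructor
    · intro h
      exact ⟨‖z‖, z.arg, h, Complex.norm_mul_exp_arg_mul_I z⟩
    · rintro ⟨r, t, hr, rfl⟩
      rw [norm_mul, Complex.norm_exp_ofReal_mul_I, mul_one, Complex.norm_real]
      exact hr.trans (le_abs_self r)
  rw [h]
  exact (isPreconnected_Ici.prod isPreconnected_univ).image _ (by fun_prop)

lemma IsClosed.connectedComponentIn {X : Type*} [TopologicalSpace X] {F : Set X}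
    (hF : IsClosed F) (x : X) : IsClosed (connectedComponentIn F x) := by
  by_cases hx : x ∈ F
  · refine isClosed_of_closure_subset ?_
    refine isPreconnected_connectedComponentIn.closure.subset_connectedComponentIn
      (subset_closure (mem_connectedComponentIn hx)) ?_
    exact closure_minimal (connectedComponentIn_subset F x) hF
  · rw [connectedComponentIn_eq_empty hx]
    exact isClosed_empty

/-- The topological hull is the complement of the unbounded component of the complement. -/
lemma exists_hullT_eq_compl {W : Set ℂ} (hWbd : Bornology.IsBounded W) :
    ∃ w ∉ W, hullT W = (connectedComponentIn Wᶜ w)ᶜ ∧ Bornology.IsBounded (hullT W) := by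
  obtain ⟨R, hR, hWR⟩ := hWbd.subset_ball_lt 0 0
  have hE : {z : ℂ | R ≤ ‖z‖} ⊆ Wᶜ := fun z hz hzW => by
    have := hWR hzW
    rw [mem_ball_zero_iff] at this
    exact absurd hz (not_le.2 this)
  have hw : (R : ℂ) ∈ {z : ℂ | R ≤ ‖z‖} := by simp [le_abs_self]
  have hEF := (isPreconnected_setOf_le_norm R).subset_connectedComponentIn hw hE
  have hEu : ¬ Bornology.IsBounded {z : ℂ | R ≤ ‖z‖} := by
    intro h
    obtain ⟨M, hM, hb⟩ := h.subset_ball_lt R 0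
    have := hb (show (M : ℂ) ∈ _ by simpa using hM.le.trans (le_abs_self M))
    rw [mem_ball_zero_iff, Complex.norm_real] at this
    exact absurd this (not_lt.2 (le_abs_self M))
  have heq : hullT W = (connectedComponentIn Wᶜ (R : ℂ))ᶜ := by
    ext z
    simp only [hullT, Set.mem_union, Set.mem_ofPred_eq, Set.mem_compl_iff]
    constructor
    · rintro (hz | ⟨hz, hb⟩) hF
      · exact connectedComponentIn_subset _ _ hF hz
      · rw [← connectedComponentIn_eq hF] at hb
        exact hEu (hb.subset hEF)
    · intro hF
      by_cases hz : z ∈ W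
      · exact Or.inl hz
      · refine Or.inr ⟨hz, (Metric.isBounded_ball (x := (0 : ℂ)) (r := R)).subset ?_⟩
        intro y hy
        rw [mem_ball_zero_iff]
        by_contra! hy'
        refine hF ?_
        rw [connectedComponentIn_eq (hEF hy'), ← connectedComponentIn_eq hy]
        exact mem_connectedComponentIn hz
  refine ⟨R, hE hw, heq, (Metric.isBounded_ball (x := (0 : ℂ)) (r := R)).subset ?_⟩
  rw [heq, Set.compl_subset_comm]
  intro z hz
  refine hEF ?_
  simpa using hz

lemma isPreconnected_hullT {W : Set ℂ} (hWne : W.Nonempty) (hWop : IsOpen W)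
    (hWconn : IsPreconnected W) : IsPreconnected (hullT W) := by
  obtain ⟨w, hw⟩ := hWne
  refine isPreconnected_of_forall w fun z hz => ?_
  rcases hz with hz | ⟨hz, hb⟩
  · exact ⟨W, Set.subset_union_left, hw, hz, hWconn⟩
  set C := connectedComponentIn Wᶜ z with hC
  have hzC : z ∈ C := mem_connectedComponentIn hz
  have hCW : C ⊆ Wᶜ := connectedComponentIn_subset _ _
  have hsub : C ⊆ hullT W := fun y hy => Or.inr ⟨hCW hy, by rwa [← connectedComponentIn_eq hy]⟩
  obtain ⟨c, hcC, hcW⟩ : (C ∩ closure W).Nonempty := by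
    by_contra hne
    rw [Set.not_nonempty_iff_eq_empty] at hne
    have hop : IsOpen C := by
      rw [Metric.isOpen_iff]
      intro y hy
      have hyW : y ∈ (closure W)ᶜ := fun h => by
        have : y ∈ C ∩ closure W := ⟨hy, h⟩
        rw [hne] at this
        exact this
      obtain ⟨ε, hε, hball⟩ := Metric.isOpen_iff.1 isClosed_closure.isOpen_compl y hyW
      refine ⟨ε, hε, ?_⟩
      rw [hC, connectedComponentIn_eq hy]
      exact (convex_ball y ε).isPreconnected.subset_connectedComponentIn (Metric.mem_ball_self hε)
        (hball.trans (Set.compl_subset_compl.2 subset_closure))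
    have huniv := IsClopen.eq_univ ⟨hWop.isClosed_compl.connectedComponentIn z, hop⟩ ⟨z, hzC⟩
    exact hCW (by rw [hC, huniv]; exact Set.mem_univ w : w ∈ C) hw
  refine ⟨insert c W ∪ C, ?_, Or.inl (Or.inr hw), Or.inr hzC, ?_⟩
  · exact Set.union_subset (Set.insert_subset (hsub hcC) Set.subset_union_left) hsub
  · refine IsPreconnected.union c (Set.mem_insert _ _) hcC ?_ isPreconnected_connectedComponentIn
    exact hWconn.subset_closure (Set.subset_insert _ _)
      (Set.insert_subset hcW subset_closure)

lemma frontier_compl_connectedComponentIn_compl_subset {W : Set ℂ} (hWop : IsOpen W) {w : ℂ} :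
    frontier (connectedComponentIn Wᶜ w)ᶜ ⊆ frontier W := by
  rw [frontier_compl, (hWop.isClosed_compl.connectedComponentIn w).frontier_eq, hWop.frontier_eq]
  rintro z ⟨hzF, hzi⟩
  refine ⟨?_, connectedComponentIn_subset _ _ hzF⟩
  by_contra hz
  obtain ⟨ε, hε, hball⟩ := Metric.isOpen_iff.1 isClosed_closure.isOpen_compl z hz
  refine hzi (mem_interior.2 ⟨Metric.ball z ε, ?_, Metric.isOpen_ball, Metric.mem_ball_self hε⟩)
  rw [connectedComponentIn_eq hzF]
  exact (convex_ball z ε).isPreconnected.subset_connectedComponentIn (Metric.mem_ball_self hε)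
    (hball.trans (Set.compl_subset_compl.2 subset_closure))

theorem hullT_properties (W : Set ℂ) (hWne : W.Nonempty)
    (hWbd : Bornology.IsBounded W) (hWop : IsOpen W) (hWconn : IsConnected W) :
    (hullT W).Nonempty ∧ Bornology.IsBounded (hullT W) ∧ IsOpen (hullT W) ∧
      IsConnected (hullT W) ∧ SimplyConnectedSpace (hullT W) ∧
      frontier (hullT W) ⊆ frontier W := by
  obtain ⟨w, -, heq, hbd⟩ := exists_hullT_eq_compl hWbd
  have hne : (hullT W).Nonempty := hWne.mono Set.subset_union_left
  have hop : IsOpen (hullT W) := by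
    rw [heq]
    exact (hWop.isClosed_compl.connectedComponentIn w).isOpen_compl
  have hconn : IsConnected (hullT W) :=
    ⟨hne, isPreconnected_hullT hWne hWop hWconn.isPreconnected⟩
  refine ⟨hne, hbd, hop, hconn, ?_, ?_⟩
  · refine hop.simplyConnectedSpace_of_isPreconnected_compl hbd ?_ hconn
    rw [heq, compl_compl]
    exact isPreconnected_connectedComponentIn
  · rw [heq]
    exact frontier_compl_connectedComponentIn_compl_subset hWop
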